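/- arXiv:2103.16537 — 9 statements merged into one kernel-verified Lean document; each statement's English description precedes it below -/
import Mathlib

section
/- Let c₁, c₂ : [0,1] → ℝ^d be C¹ curves with nonvanishing derivatives and let φ ∈ Diff₊(I). Then ∫₀¹ ⟨Q(c₁∘φ)(t), Q(c₂∘φ)(t)⟩ dt = ∫₀¹ ⟨Q(c₁)(t), Q(c₂)(t)⟩ dt, and hence the SRV distance is invariant under simultaneous reparametrisation: dist(c₁∘φ, c₂∘φ) = dist(c₁, c₂). -/
open Set MeasureTheory
open scoped RealInnerProductSpace

/-- The derivative of a curve `c : [0,1] → ℝ^d` (taken within `[0,1]`). -/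
noncomputable def cderiv {d : ℕ} (c : ℝ → EuclideanSpace ℝ (Fin d)) (t : ℝ) :
    EuclideanSpace ℝ (Fin d) :=
  derivWithin c (Icc 0 1) t

/-- The length of a curve `c : [0,1] → ℝ^d`. -/
noncomputable def clen {d : ℕ} (c : ℝ → EuclideanSpace ℝ (Fin d)) : ℝ :=
  ∫ t in (0:ℝ)..1, ‖cderiv c t‖

/-- The (scaled) square root velocity transform
`Q(c)(t) = c'(t) / (√(len c) · √|c'(t)|)`. -/
noncomputable def srvt {d : ℕ} (c : ℝ → EuclideanSpace ℝ (Fin d)) (t : ℝ) :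
    EuclideanSpace ℝ (Fin d) :=
  (Real.sqrt (clen c) * Real.sqrt ‖cderiv c t‖)⁻¹ • cderiv c t

/-- `c` is a `C¹` immersion of `[0,1]` into `ℝ^d`. -/
def IsImmersion {d : ℕ} (c : ℝ → EuclideanSpace ℝ (Fin d)) : Prop :=
  ContDiffOn ℝ 1 c (Icc 0 1) ∧ ∀ t ∈ Icc (0:ℝ) 1, cderiv c t ≠ 0

/-- The SRV distance `dist(c₁,c₂) = arccos(∫₀¹ ⟨Q(c₁)(t), Q(c₂)(t)⟩ dt)`. -/
noncomputable def srvDist {d : ℕ} (c₁ c₂ : ℝ → EuclideanSpace ℝ (Fin d)) : ℝ :=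
  Real.arccos (∫ t in (0:ℝ)..1, ⟪srvt c₁ t, srvt c₂ t⟫)

/-- `φ ∈ Diff₊(I)`: an orientation preserving `C¹` diffeomorphism of `[0,1]`. -/
def IsReparam (φ : ℝ → ℝ) : Prop :=
  ContDiffOn ℝ 1 φ (Icc 0 1) ∧ MapsTo φ (Icc 0 1) (Icc 0 1) ∧
  φ 0 = 0 ∧ φ 1 = 1 ∧ ∀ t ∈ Icc (0:ℝ) 1, 0 < derivWithin φ (Icc 0 1) t

/-- Change of variables on `[0,1]` under a reparametrisation; no regularity of `g` is needed. -/
theorem IsReparam.integral_deriv_mul_comp {φ : ℝ → ℝ} (hφ : IsReparam φ) (g : ℝ → ℝ) :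
    ∫ t in (0:ℝ)..1, derivWithin φ (Icc 0 1) t * g (φ t) = ∫ t in (0:ℝ)..1, g t := by
  obtain ⟨hC, -, h0, h1, hpos⟩ := hφ
  have h := intervalIntegral.integral_comp_mul_deriv_of_deriv_nonneg (a := 0) (b := 1) (f := φ)
    (f' := derivWithin φ (Icc 0 1)) (g := g)
    (by simpa [uIcc_of_le] using hC.continuousOn)
    (fun x hx => by
      simp only [zero_le_one, min_eq_left, max_eq_right] at hx
      exact ((hC.differentiableOn one_ne_zero) x
        (Ioo_subset_Icc_self hx)).hasDerivWithinAt.hasDerivAt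
          (Icc_mem_nhds hx.1 hx.2))
    (fun x hx => by
      simp only [zero_le_one, min_eq_left, max_eq_right] at hx
      exact (hpos x (Ioo_subset_Icc_self hx)).le)
  rw [h0, h1] at h
  rw [← h]
  exact intervalIntegral.integral_congr fun t _ => mul_comm _ _

/-- The chain rule for a reparametrised curve. -/
theorem cderiv_comp {d : ℕ} {c : ℝ → EuclideanSpace ℝ (Fin d)} {φ : ℝ → ℝ}
    (hc : IsImmersion c) (hφ : IsReparam φ) {t : ℝ} (ht : t ∈ Icc (0:ℝ) 1) :
    cderiv (c ∘ φ) t = derivWithin φ (Icc 0 1) t • cderiv c (φ t) :=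
  derivWithin.scomp t (hc.1.differentiableOn one_ne_zero _ (hφ.2.1 ht))
    (hφ.1.differentiableOn one_ne_zero _ ht) hφ.2.1

/-- The length is invariant under reparametrisation. -/
theorem clen_comp {d : ℕ} {c : ℝ → EuclideanSpace ℝ (Fin d)} {φ : ℝ → ℝ}
    (hc : IsImmersion c) (hφ : IsReparam φ) : clen (c ∘ φ) = clen c := by
  unfold clen
  rw [← hφ.integral_deriv_mul_comp fun t => ‖cderiv c t‖]
  refine intervalIntegral.integral_congr fun t ht => ?_
  rw [uIcc_of_le zero_le_one] at ht
  simp only [cderiv_comp hc hφ ht, norm_smul, Real.norm_of_nonneg (hφ.2.2.2.2 t ht).le]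

/-- Reparametrisation acts on the SRVT by `Q(c ∘ φ) = √φ' • (Q(c) ∘ φ)`. -/
theorem srvt_comp {d : ℕ} {c : ℝ → EuclideanSpace ℝ (Fin d)} {φ : ℝ → ℝ}
    (hc : IsImmersion c) (hφ : IsReparam φ) {t : ℝ} (ht : t ∈ Icc (0:ℝ) 1) :
    srvt (c ∘ φ) t = Real.sqrt (derivWithin φ (Icc 0 1) t) • srvt c (φ t) := by
  have hpos := hφ.2.2.2.2 t ht
  have hs : Real.sqrt (derivWithin φ (Icc 0 1) t) ≠ 0 := (Real.sqrt_pos.2 hpos).ne'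
  unfold srvt
  rw [clen_comp hc hφ, cderiv_comp hc hφ ht, norm_smul, Real.norm_of_nonneg hpos.le,
    Real.sqrt_mul hpos.le, smul_smul, smul_smul]
  congr 1
  simp only [mul_inv]
  nth_rewrite 2 [← Real.mul_self_sqrt hpos.le]
  field_simp

/-- The SRV distance is invariant under simultaneous reparametrisation:
`∫₀¹ ⟨Q(c₁∘φ), Q(c₂∘φ)⟩ = ∫₀¹ ⟨Q(c₁), Q(c₂)⟩` and hence
`dist(c₁∘φ, c₂∘φ) = dist(c₁, c₂)`. -/
theorem srvDist_simultaneous_reparam_invariant {d : ℕ}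
    (c₁ c₂ : ℝ → EuclideanSpace ℝ (Fin d)) (φ : ℝ → ℝ)
    (hc₁ : IsImmersion c₁) (hc₂ : IsImmersion c₂) (hφ : IsReparam φ) :
    (∫ t in (0:ℝ)..1, ⟪srvt (c₁ ∘ φ) t, srvt (c₂ ∘ φ) t⟫) =
        (∫ t in (0:ℝ)..1, ⟪srvt c₁ t, srvt c₂ t⟫) ∧
      srvDist (c₁ ∘ φ) (c₂ ∘ φ) = srvDist c₁ c₂ := by
  have key : (∫ t in (0:ℝ)..1, ⟪srvt (c₁ ∘ φ) t, srvt (c₂ ∘ φ) t⟫) =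
      ∫ t in (0:ℝ)..1, ⟪srvt c₁ t, srvt c₂ t⟫ := by
    rw [← hφ.integral_deriv_mul_comp fun t => ⟪srvt c₁ t, srvt c₂ t⟫]
    refine intervalIntegral.integral_congr fun t ht => ?_
    rw [uIcc_of_le zero_le_one] at ht
    simp only [srvt_comp hc₁ hφ ht, srvt_comp hc₂ hφ ht, real_inner_smul_left,
      real_inner_smul_right]
    rw [← mul_assoc, Real.mul_self_sqrt (hφ.2.2.2.2 t ht).le]
  exact ⟨key, congrArg Real.arccos key⟩
end

section
/- Let c : [0,1] → ℝ^d be a C¹ curve with c'(t) ≠ 0 for all t, c(0) = 0 and len(c) = 1, and let q = Q(c). Then the inverse SRVT recovers the curve: for every t ∈ [0,1], ∫₀ᵗ |q(s)| · q(s) ds = c(t). -/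
open Set MeasureTheory

/-- The derivative of a curve of unit length is recovered from its SRVT. -/
theorem norm_srvt_smul_srvt_of_clen_eq_one {d : ℕ} {c : ℝ → EuclideanSpace ℝ (Fin d)}
    (hlen : clen c = 1) (t : ℝ) : ‖srvt c t‖ • srvt c t = cderiv c t := by
  rcases eq_or_ne (cderiv c t) 0 with h | h
  · simp [srvt, h]
  have hpos : 0 < ‖cderiv c t‖ := norm_pos_iff.mpr h
  rw [srvt, hlen, Real.sqrt_one, one_mul, norm_smul, smul_smul, norm_inv, Real.norm_eq_abs,
    abs_of_nonneg (Real.sqrt_nonneg _)]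
  have hcoef : (√‖cderiv c t‖)⁻¹ * ‖cderiv c t‖ * (√‖cderiv c t‖)⁻¹ = 1 := by
    have hsqrt := Real.sqrt_pos.mpr hpos
    field_simp
    exact (Real.sq_sqrt hpos.le).symm
  rw [hcoef, one_smul]

/-- For a `C¹` immersion `c` with `c(0) = 0` and `len(c) = 1`, the inverse
SRVT recovers the curve: `∫₀ᵗ |q(s)| q(s) ds = c(t)` where `q = Q(c)`. -/
theorem srvt_inverse {d : ℕ} (c : ℝ → EuclideanSpace ℝ (Fin d))
    (hc : IsImmersion c) (h0 : c 0 = 0) (hlen : clen c = 1) :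
    ∀ t ∈ Icc (0:ℝ) 1, (∫ s in (0:ℝ)..t, ‖srvt c s‖ • srvt c s) = c t := by
  intro t ht
  simp_rw [norm_srvt_smul_srvt_of_clen_eq_one hlen]
  have hsub : Icc 0 t ⊆ Icc (0:ℝ) 1 := Icc_subset_Icc_right ht.2
  have hcont : ContinuousOn (cderiv c) (Icc 0 1) :=
    hc.1.continuousOn_derivWithin (uniqueDiffOn_Icc one_pos) le_rfl
  rw [intervalIntegral.integral_eq_sub_of_hasDerivAt_of_le ht.1 (hc.1.continuousOn.mono hsub)
    (fun s hs => ?_) ((hcont.mono hsub).intervalIntegrable_of_Icc ht.1), h0, sub_zero]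
  have hs1 : s < 1 := hs.2.trans_le ht.2
  exact ((hc.1.differentiableOn one_ne_zero) s ⟨hs.1.le, hs1.le⟩).hasDerivWithinAt.hasDerivAt
    (Icc_mem_nhds hs.1 hs1)
end

section
/- Let f : [0,1]² → ℝ be continuous and nonnegative, and let u be the associated value function. Then u satisfies the dynamic programming principle: for every path φ = (φ₁, φ₂) : [0,1] → [0,1]² with absolutely continuous monotone nondecreasing components and φ(0) = (0,0), and for all 0 ≤ s ≤ t ≤ 1, one has u(φ(t)) ≥ u(φ(s)) + ∫ₛᵗ f(φ(r)) √(φ₁'(r) φ₂'(r)) dr. -/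
open Set MeasureTheory

/-- The point reached at time `t` by the monotone absolutely continuous path
component with (a.e.) derivative `g` starting at `0`:  `φ(t) = ∫₀ᵗ g`. -/
noncomputable def pathPoint (g : ℝ → ℝ) (t : ℝ) : ℝ :=
  ∫ s in (0:ℝ)..t, g s

/-- The cost `∫ₛᵗ f(φ(r)) √(φ₁'(r) φ₂'(r)) dr` of the path with component
derivatives `g₁, g₂`. -/
noncomputable def pathCost (f : ℝ × ℝ → ℝ) (g₁ g₂ : ℝ → ℝ) (s t : ℝ) : ℝ :=
  ∫ r in s..t, f (pathPoint g₁ r, pathPoint g₂ r) * Real.sqrt (g₁ r * g₂ r)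

/-- `g₁, g₂` are the (a.e.) derivatives of an admissible path from `(0,0)` to
`x`: each component is absolutely continuous (being an integral of an
integrable function) and monotone nondecreasing (`gᵢ ≥ 0`), and the path ends
at `x`. -/
def IsAdmissiblePath (x : ℝ × ℝ) (g₁ g₂ : ℝ → ℝ) : Prop :=
  IntervalIntegrable g₁ volume 0 1 ∧ IntervalIntegrable g₂ volume 0 1 ∧
  (∀ t, 0 ≤ g₁ t) ∧ (∀ t, 0 ≤ g₂ t) ∧
  pathPoint g₁ 1 = x.1 ∧ pathPoint g₂ 1 = x.2

/-- The value function `u(x) = sup_{φ ∈ A(x)} ∫₀¹ f(φ(t)) √(φ₁'(t) φ₂'(t)) dt`. -/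
noncomputable def valueFun (f : ℝ × ℝ → ℝ) (x : ℝ × ℝ) : ℝ :=
  sSup { J : ℝ | ∃ g₁ g₂ : ℝ → ℝ, IsAdmissiblePath x g₁ g₂ ∧ J = pathCost f g₁ g₂ 0 1 }
theorem pathPoint_mono {g : ℝ → ℝ} (hg : IntervalIntegrable g volume 0 1)
    (hg0 : ∀ t, 0 ≤ g t) {s t : ℝ} (hs : 0 ≤ s) (hst : s ≤ t) (ht : t ≤ 1) :
    pathPoint g s ≤ pathPoint g t := by
  refine intervalIntegral.integral_mono_interval le_rfl hs hst (ae_of_all _ hg0) ?_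
  refine hg.mono_set ?_
  rw [uIcc_of_le (hs.trans hst), uIcc_of_le zero_le_one]
  exact Icc_subset_Icc_right ht

theorem pathPoint_nonneg {g : ℝ → ℝ} (hg0 : ∀ t, 0 ≤ g t) {t : ℝ} (ht : 0 ≤ t) :
    0 ≤ pathPoint g t :=
  intervalIntegral.integral_nonneg ht fun u _ => hg0 u

theorem continuousOn_pathPoint {g : ℝ → ℝ} (hg : IntervalIntegrable g volume 0 1) :
    ContinuousOn (pathPoint g) (Icc 0 1) := by
  have h := intervalIntegral.continuousOn_primitive_interval' hg (left_mem_uIcc)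
  rwa [uIcc_of_le zero_le_one] at h

theorem pathPoint_mem_Icc {g : ℝ → ℝ} (hg : IntervalIntegrable g volume 0 1)
    (hg0 : ∀ t, 0 ≤ g t) (hend : pathPoint g 1 ≤ 1) {t : ℝ} (ht : t ∈ Icc (0:ℝ) 1) :
    pathPoint g t ∈ Icc (0:ℝ) 1 :=
  ⟨pathPoint_nonneg hg0 ht.1, (pathPoint_mono hg hg0 ht.1 ht.2 le_rfl).trans hend⟩

theorem sqrt_mul_le_add {a b : ℝ} (ha : 0 ≤ a) (hb : 0 ≤ b) : √(a * b) ≤ a + b := by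
  rw [Real.sqrt_le_left (by positivity)]
  nlinarith [mul_nonneg ha hb]

theorem intervalIntegrable_sqrt_mul {g₁ g₂ : ℝ → ℝ} {a b : ℝ}
    (hg₁ : IntervalIntegrable g₁ volume a b) (hg₂ : IntervalIntegrable g₂ volume a b)
    (hg₁0 : ∀ t, 0 ≤ g₁ t) (hg₂0 : ∀ t, 0 ≤ g₂ t) :
    IntervalIntegrable (fun r => √(g₁ r * g₂ r)) volume a b := by
  refine (hg₁.add hg₂).mono_fun' ?_ (ae_of_all _ fun r => ?_)
  · exact Real.continuous_sqrt.comp_aestronglyMeasurable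
      (hg₁.aestronglyMeasurable_restrict_uIoc.mul hg₂.aestronglyMeasurable_restrict_uIoc)
  · simp only [Real.norm_of_nonneg (Real.sqrt_nonneg _)]
    exact sqrt_mul_le_add (hg₁0 r) (hg₂0 r)

theorem intervalIntegrable_pathCost {f : ℝ × ℝ → ℝ}
    (hf : ContinuousOn f (Icc 0 1 ×ˢ Icc 0 1)) {g₁ g₂ : ℝ → ℝ}
    (hg₁ : IntervalIntegrable g₁ volume 0 1) (hg₂ : IntervalIntegrable g₂ volume 0 1)
    (hg₁0 : ∀ t, 0 ≤ g₁ t) (hg₂0 : ∀ t, 0 ≤ g₂ t)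
    (hend₁ : pathPoint g₁ 1 ≤ 1) (hend₂ : pathPoint g₂ 1 ≤ 1) :
    IntervalIntegrable (fun r => f (pathPoint g₁ r, pathPoint g₂ r) * √(g₁ r * g₂ r))
      volume 0 1 := by
  refine (intervalIntegrable_sqrt_mul hg₁ hg₂ hg₁0 hg₂0).continuousOn_mul ?_
  rw [uIcc_of_le zero_le_one]
  exact hf.comp ((continuousOn_pathPoint hg₁).prodMk (continuousOn_pathPoint hg₂))
    fun r hr => ⟨pathPoint_mem_Icc hg₁ hg₁0 hend₁ hr, pathPoint_mem_Icc hg₂ hg₂0 hend₂ hr⟩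

theorem bddAbove_pathCost {f : ℝ × ℝ → ℝ} (hf : ContinuousOn f (Icc 0 1 ×ˢ Icc 0 1))
    {x : ℝ × ℝ} (hx₁ : x.1 ≤ 1) (hx₂ : x.2 ≤ 1) :
    BddAbove {J : ℝ | ∃ g₁ g₂ : ℝ → ℝ, IsAdmissiblePath x g₁ g₂ ∧ J = pathCost f g₁ g₂ 0 1} := by
  obtain ⟨M, hM⟩ := (isCompact_Icc.prod isCompact_Icc).exists_bound_of_continuousOn hf
  refine ⟨M * (x.1 + x.2), ?_⟩
  rintro J ⟨g₁, g₂, ⟨hg₁, hg₂, hg₁0, hg₂0, he₁, he₂⟩, rfl⟩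
  have hx : M * (x.1 + x.2) = ∫ r in (0:ℝ)..1, M * (g₁ r + g₂ r) := by
    rw [intervalIntegral.integral_const_mul, intervalIntegral.integral_add hg₁ hg₂, ← he₁, ← he₂]
    rfl
  rw [hx]
  refine intervalIntegral.integral_mono_on zero_le_one
    (intervalIntegrable_pathCost hf hg₁ hg₂ hg₁0 hg₂0 (he₁.trans_le hx₁) (he₂.trans_le hx₂))
    ((hg₁.add hg₂).const_mul M) fun r hr => ?_
  have hfM := hM (pathPoint g₁ r, pathPoint g₂ r)
    ⟨pathPoint_mem_Icc hg₁ hg₁0 (he₁.trans_le hx₁) hr,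
      pathPoint_mem_Icc hg₂ hg₂0 (he₂.trans_le hx₂) hr⟩
  exact mul_le_mul ((le_abs_self _).trans hfM) (sqrt_mul_le_add (hg₁0 r) (hg₂0 r))
    (Real.sqrt_nonneg _) ((norm_nonneg _).trans hfM)

/-- The derivative of the concatenation of a path with derivative `h`, run at double speed on
`[0, 1/2]`, and a path with derivative `g`, reparametrized by `r ↦ d + c * r`. -/
noncomputable def concatDeriv (h g : ℝ → ℝ) (c d r : ℝ) : ℝ :=
  if r ≤ 1 / 2 then 2 * h (2 * r) else c * g (d + c * r)

section Concat

variable {h g : ℝ → ℝ} {c d r : ℝ}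

theorem concatDeriv_of_le (hr : r ≤ 1 / 2) : concatDeriv h g c d r = 2 * h (2 * r) := if_pos hr

theorem concatDeriv_of_lt (hr : 1 / 2 < r) : concatDeriv h g c d r = c * g (d + c * r) :=
  if_neg hr.not_ge

theorem concatDeriv_nonneg (hh : ∀ t, 0 ≤ h t) (hg : ∀ t, 0 ≤ g t) (hc : 0 ≤ c) :
    0 ≤ concatDeriv h g c d r := by
  unfold concatDeriv
  split_ifs
  · exact mul_nonneg zero_le_two (hh _)
  · exact mul_nonneg hc (hg _)

theorem intervalIntegrable_concatDeriv_left (hh : IntervalIntegrable h volume 0 1) :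
    IntervalIntegrable (concatDeriv h g c d) volume 0 (1 / 2) := by
  have h2 : IntervalIntegrable (fun r => 2 * h (2 * r)) volume 0 (1 / 2) := by
    simpa using (hh.comp_mul_left (c := 2)).const_mul 2
  refine h2.congr fun r hr => ?_
  rw [uIoc_of_le (by norm_num)] at hr
  exact (concatDeriv_of_le hr.2).symm

theorem intervalIntegrable_concatDeriv_right (hc : c ≠ 0)
    (hg : IntervalIntegrable g volume (d + c * (1 / 2)) (d + c * 1)) :
    IntervalIntegrable (concatDeriv h g c d) volume (1 / 2) 1 := by
  have h2 : IntervalIntegrable (fun r => c * g (d + c * r)) volume (1 / 2) 1 := by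
    have := ((hg.comp_add_left d).comp_mul_left (c := c)).const_mul c
    simpa [hc] using this
  refine h2.congr fun r hr => ?_
  rw [uIoc_of_le (by norm_num)] at hr
  exact (concatDeriv_of_lt hr.1).symm

theorem pathPoint_concatDeriv_left (hr0 : 0 ≤ r) (hr : r ≤ 1 / 2) :
    pathPoint (concatDeriv h g c d) r = pathPoint h (2 * r) := by
  have : pathPoint (concatDeriv h g c d) r = ∫ x in (0:ℝ)..r, 2 * h (2 * x) := by
    refine intervalIntegral.integral_congr_ae (ae_of_all _ fun x hx => ?_)
    rw [uIoc_of_le hr0] at hx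
    exact concatDeriv_of_le (hx.2.trans hr)
  rw [this, intervalIntegral.integral_const_mul, intervalIntegral.mul_integral_comp_mul_left,
    mul_zero]
  rfl

theorem pathPoint_concatDeriv_right (hc : 0 < c) (hh : IntervalIntegrable h volume 0 1)
    (hg : IntervalIntegrable g volume 0 1) (hd : 0 ≤ d + c * (1 / 2)) (hcd : d + c * 1 ≤ 1)
    (hjoin : pathPoint h 1 = pathPoint g (d + c * (1 / 2))) (hr : 1 / 2 ≤ r) (hr1 : r ≤ 1) :
    pathPoint (concatDeriv h g c d) r = pathPoint g (d + c * r) := by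
  have hsub : ∀ {a b : ℝ}, 0 ≤ a → a ≤ b → b ≤ 1 → IntervalIntegrable g volume a b := by
    intro a b ha hab hb
    refine hg.mono_set ?_
    rw [uIcc_of_le hab, uIcc_of_le zero_le_one]
    exact Icc_subset_Icc ha hb
  have hle : d + c * (1 / 2) ≤ d + c * r := by gcongr
  have hle1 : d + c * r ≤ 1 := le_trans (by gcongr) hcd
  have hright : IntervalIntegrable (concatDeriv h g c d) volume (1 / 2) r := by
    refine (intervalIntegrable_concatDeriv_right hc.ne'
      (hsub hd (hle.trans (by gcongr)) hcd)).mono_set ?_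
    rw [uIcc_of_le hr, uIcc_of_le (hr.trans hr1)]
    exact Icc_subset_Icc_right hr1
  have htail : ∫ x in (1 / 2)..r, concatDeriv h g c d x = ∫ x in (1 / 2)..r, c * g (d + c * x) := by
    refine intervalIntegral.integral_congr_ae (ae_of_all _ fun x hx => ?_)
    rw [uIoc_of_le hr] at hx
    exact concatDeriv_of_lt hx.1
  have hhalf : ∫ x in (0:ℝ)..(1 / 2), concatDeriv h g c d x = pathPoint g (d + c * (1 / 2)) := by
    have := pathPoint_concatDeriv_left (h := h) (g := g) (c := c) (d := d)
      one_half_pos.le le_rfl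
    rwa [mul_one_div_cancel two_ne_zero, hjoin] at this
  unfold pathPoint
  rw [← intervalIntegral.integral_add_adjacent_intervals
      (intervalIntegrable_concatDeriv_left hh) hright, hhalf, htail,
    intervalIntegral.integral_const_mul, intervalIntegral.mul_integral_comp_add_mul]
  exact intervalIntegral.integral_add_adjacent_intervals
    (hsub le_rfl hd (hle.trans hle1)) (hsub hd hle hle1)

end Concat

theorem sqrt_mul_mul_mul_self {c : ℝ} (hc : 0 ≤ c) (a b : ℝ) :
    √(c * a * (c * b)) = c * √(a * b) := by
  rw [mul_mul_mul_comm, Real.sqrt_mul (mul_self_nonneg c), Real.sqrt_mul_self hc]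

/-- Concatenating an admissible path to `φ(s)` with the restriction of `φ` to `[s, t]` gives an
admissible path to `φ(t)`, and the costs add up. -/
theorem exists_isAdmissiblePath_concat {f : ℝ × ℝ → ℝ}
    (hf : ContinuousOn f (Icc 0 1 ×ˢ Icc 0 1)) {g₁ g₂ h₁ h₂ : ℝ → ℝ}
    (hg₁ : IntervalIntegrable g₁ volume 0 1) (hg₂ : IntervalIntegrable g₂ volume 0 1)
    (hg₁0 : ∀ t, 0 ≤ g₁ t) (hg₂0 : ∀ t, 0 ≤ g₂ t)
    (hend₁ : pathPoint g₁ 1 ≤ 1) (hend₂ : pathPoint g₂ 1 ≤ 1)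
    {s t : ℝ} (hs : 0 ≤ s) (hst : s < t) (ht : t ≤ 1)
    (hh : IsAdmissiblePath (pathPoint g₁ s, pathPoint g₂ s) h₁ h₂) :
    ∃ k₁ k₂ : ℝ → ℝ, IsAdmissiblePath (pathPoint g₁ t, pathPoint g₂ t) k₁ k₂ ∧
      pathCost f h₁ h₂ 0 1 + pathCost f g₁ g₂ s t = pathCost f k₁ k₂ 0 1 := by
  obtain ⟨hh₁, hh₂, hh₁0, hh₂0, he₁, he₂⟩ := hh
  obtain ⟨c, hc⟩ : ∃ c, c = 2 * (t - s) := ⟨_, rfl⟩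
  obtain ⟨d, hd⟩ : ∃ d, d = 2 * s - t := ⟨_, rfl⟩
  have hc0 : 0 < c := by linarith
  have hs' : d + c * (1 / 2) = s := by rw [hc, hd]; ring
  have ht' : d + c * 1 = t := by rw [hc, hd]; ring
  have hint : ∀ {h g : ℝ → ℝ}, IntervalIntegrable h volume 0 1 → IntervalIntegrable g volume 0 1 →
      IntervalIntegrable (concatDeriv h g c d) volume 0 1 := by
    intro h g hh hg
    refine (intervalIntegrable_concatDeriv_left hh).trans
      (intervalIntegrable_concatDeriv_right hc0.ne' (hg.mono_set ?_))
    rw [hs', ht', uIcc_of_le hst.le, uIcc_of_le zero_le_one]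
    exact Icc_subset_Icc hs ht
  have hpt : ∀ {h g : ℝ → ℝ}, IntervalIntegrable h volume 0 1 → IntervalIntegrable g volume 0 1 →
      pathPoint h 1 = pathPoint g s → ∀ {r : ℝ}, 1 / 2 ≤ r → r ≤ 1 →
      pathPoint (concatDeriv h g c d) r = pathPoint g (d + c * r) := fun hh hg he _ hr hr1 =>
    pathPoint_concatDeriv_right hc0 hh hg (hs'.symm ▸ hs) (ht'.symm ▸ ht) (hs'.symm ▸ he) hr hr1
  have hk₁ := hpt hh₁ hg₁ he₁ (by norm_num : (1:ℝ) / 2 ≤ 1) le_rfl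
  have hk₂ := hpt hh₂ hg₂ he₂ (by norm_num : (1:ℝ) / 2 ≤ 1) le_rfl
  rw [ht'] at hk₁ hk₂
  have hk₁0 : ∀ r, 0 ≤ concatDeriv h₁ g₁ c d r := fun r => concatDeriv_nonneg hh₁0 hg₁0 hc0.le
  have hk₂0 : ∀ r, 0 ≤ concatDeriv h₂ g₂ c d r := fun r => concatDeriv_nonneg hh₂0 hg₂0 hc0.le
  refine ⟨concatDeriv h₁ g₁ c d, concatDeriv h₂ g₂ c d,
    ⟨hint hh₁ hg₁, hint hh₂ hg₂, hk₁0, hk₂0, hk₁, hk₂⟩, ?_⟩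
  have hcost := intervalIntegrable_pathCost hf (hint hh₁ hg₁) (hint hh₂ hg₂) hk₁0 hk₂0
    (hk₁.trans_le ((pathPoint_mono hg₁ hg₁0 (hs.trans hst.le) ht le_rfl).trans hend₁))
    (hk₂.trans_le ((pathPoint_mono hg₂ hg₂0 (hs.trans hst.le) ht le_rfl).trans hend₂))
  have hmem : (1 / 2 : ℝ) ∈ uIcc (0:ℝ) 1 := by rw [uIcc_of_le zero_le_one]; constructor <;> norm_num
  have hleft : pathCost f (concatDeriv h₁ g₁ c d) (concatDeriv h₂ g₂ c d) 0 (1 / 2)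
      = pathCost f h₁ h₂ 0 1 := by
    have hsubst := intervalIntegral.mul_integral_comp_mul_left (a := 0) (b := 1 / 2)
      (f := fun r => f (pathPoint h₁ r, pathPoint h₂ r) * √(h₁ r * h₂ r)) 2
    rw [mul_zero, mul_one_div_cancel two_ne_zero] at hsubst
    unfold pathCost
    rw [← hsubst, ← intervalIntegral.integral_const_mul]
    refine intervalIntegral.integral_congr_ae (ae_of_all _ fun r hr => ?_)
    rw [uIoc_of_le (by norm_num)] at hr
    rw [pathPoint_concatDeriv_left hr.1.le hr.2, pathPoint_concatDeriv_left hr.1.le hr.2,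
      concatDeriv_of_le hr.2, concatDeriv_of_le hr.2, sqrt_mul_mul_mul_self zero_le_two]
    ring
  have hright : pathCost f (concatDeriv h₁ g₁ c d) (concatDeriv h₂ g₂ c d) (1 / 2) 1
      = pathCost f g₁ g₂ s t := by
    have hsubst := intervalIntegral.mul_integral_comp_add_mul (a := 1 / 2) (b := 1)
      (f := fun r => f (pathPoint g₁ r, pathPoint g₂ r) * √(g₁ r * g₂ r)) c d
    rw [hs', ht'] at hsubst
    unfold pathCost
    rw [← hsubst, ← intervalIntegral.integral_const_mul]
    refine intervalIntegral.integral_congr_ae (ae_of_all _ fun r hr => ?_)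
    rw [uIoc_of_le (by norm_num)] at hr
    rw [hpt hh₁ hg₁ he₁ hr.1.le hr.2, hpt hh₂ hg₂ he₂ hr.1.le hr.2,
      concatDeriv_of_lt hr.1, concatDeriv_of_lt hr.1, sqrt_mul_mul_mul_self hc0.le]
    ring
  rw [← hleft, ← hright]
  exact intervalIntegral.integral_add_adjacent_intervals
    (hcost.mono_set (uIcc_subset_uIcc_left hmem)) (hcost.mono_set (uIcc_subset_uIcc_right hmem))

theorem isAdmissiblePath_const {x : ℝ × ℝ} (hx₁ : 0 ≤ x.1) (hx₂ : 0 ≤ x.2) :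
    IsAdmissiblePath x (fun _ => x.1) (fun _ => x.2) :=
  ⟨intervalIntegrable_const, intervalIntegrable_const, fun _ => hx₁, fun _ => hx₂,
    by simp [pathPoint], by simp [pathPoint]⟩

/-- The dynamic programming principle: along any admissible path `φ` (staying
in `[0,1]²`, given by its component derivatives `g₁, g₂`) and for all
`0 ≤ s ≤ t ≤ 1`,
`u(φ(t)) ≥ u(φ(s)) + ∫ₛᵗ f(φ(r)) √(φ₁'(r) φ₂'(r)) dr`. -/
theorem valueFun_dpp (f : ℝ × ℝ → ℝ)
    (hf : ContinuousOn f (Icc 0 1 ×ˢ Icc 0 1))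
    (hf0 : ∀ x ∈ Icc (0:ℝ) 1 ×ˢ Icc (0:ℝ) 1, 0 ≤ f x)
    (g₁ g₂ : ℝ → ℝ)
    (hg₁ : IntervalIntegrable g₁ volume 0 1)
    (hg₂ : IntervalIntegrable g₂ volume 0 1)
    (hg₁0 : ∀ t, 0 ≤ g₁ t) (hg₂0 : ∀ t, 0 ≤ g₂ t)
    (hend₁ : pathPoint g₁ 1 ≤ 1) (hend₂ : pathPoint g₂ 1 ≤ 1)
    (s t : ℝ) (hs : 0 ≤ s) (hst : s ≤ t) (ht : t ≤ 1) :
    valueFun f (pathPoint g₁ s, pathPoint g₂ s) + pathCost f g₁ g₂ s t ≤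
      valueFun f (pathPoint g₁ t, pathPoint g₂ t) := by
  rcases hst.eq_or_lt with rfl | hlt
  · simp [pathCost]
  rw [← le_sub_iff_add_le]
  refine csSup_le ⟨_, _, _, isAdmissiblePath_const (pathPoint_nonneg hg₁0 hs)
    (pathPoint_nonneg hg₂0 hs), rfl⟩ ?_
  rintro J ⟨h₁, h₂, hh, rfl⟩
  rw [le_sub_iff_add_le]
  obtain ⟨k₁, k₂, hk, hcost⟩ := exists_isAdmissiblePath_concat hf hg₁ hg₂ hg₁0 hg₂0
    hend₁ hend₂ hs hlt ht hh
  exact le_csSup (bddAbove_pathCost hf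
    ((pathPoint_mono hg₁ hg₁0 (hs.trans hst) ht le_rfl).trans hend₁)
    ((pathPoint_mono hg₂ hg₂0 (hs.trans hst) ht le_rfl).trans hend₂)) ⟨k₁, k₂, hk, hcost⟩
end

section
/- Let a, b ∈ ℝ and F ≥ 0. Then the maximum over α ∈ [0,1] of (α·a + (1−α)·b + F·√(α(1−α))) equals ½(a + b + √((a−b)² + F²)). -/
open Set

/-- Closed form solution of the semi-discretised scheme (U₁): for `F ≥ 0`,
`max_{α ∈ [0,1]} (αa + (1−α)b + F√(α(1−α))) = ½(a + b + √((a−b)² + F²))`. -/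
theorem scheme_U1_closed_form (a b F : ℝ) (hF : 0 ≤ F) :
    IsGreatest
      ((fun α : ℝ => α * a + (1 - α) * b + F * Real.sqrt (α * (1 - α))) ''
        Icc (0:ℝ) 1)
      ((a + b + Real.sqrt ((a - b) ^ 2 + F ^ 2)) / 2) := by
  constructor
  · set S := Real.sqrt ((a - b) ^ 2 + F ^ 2) with hS
    have hS_sq : S ^ 2 = (a - b) ^ 2 + F ^ 2 := Real.sq_sqrt (by positivity)
    have hS_nonneg : 0 ≤ S := Real.sqrt_nonneg _
    rcases hS_nonneg.eq_or_lt with h | hS_pos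
    · rw [← h] at hS_sq ⊢
      have hab : a - b = 0 := by nlinarith [sq_nonneg (a - b), sq_nonneg F]
      refine ⟨0, by simp, ?_⟩
      simp
      linarith
    · have habs : |a - b| ≤ S := abs_le_of_sq_le_sq (by nlinarith [sq_nonneg F]) hS_nonneg
      obtain ⟨hlo, hhi⟩ := abs_le.mp habs
      refine ⟨(S + (a - b)) / (2 * S), ⟨by apply div_nonneg <;> linarith, ?_⟩, ?_⟩
      · rw [div_le_one (by positivity)]
        linarith
      · have hprod : (S + (a - b)) / (2 * S) * (1 - (S + (a - b)) / (2 * S)) =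
            (F / (2 * S)) ^ 2 := by
          field_simp
          linear_combination hS_sq
        simp only [hprod]
        rw [Real.sqrt_sq (by positivity)]
        field_simp
        linear_combination -hS_sq
  · rintro _ ⟨α, ⟨h0, h1⟩, rfl⟩
    have hr := Real.sq_sqrt (mul_nonneg h0 (sub_nonneg.mpr h1))
    set r := Real.sqrt (α * (1 - α))
    have hle : (2 * α - 1) * (a - b) + 2 * r * F ≤ Real.sqrt ((a - b) ^ 2 + F ^ 2) := by
      apply Real.le_sqrt_of_sq_le
      have hcs : (a - b) ^ 2 + F ^ 2 - ((2 * α - 1) * (a - b) + 2 * r * F) ^ 2 =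
          ((2 * α - 1) * F - 2 * r * (a - b)) ^ 2 := by
        linear_combination (-4 * ((a - b) ^ 2 + F ^ 2)) * hr
      linarith [sq_nonneg ((2 * α - 1) * F - 2 * r * (a - b))]
    dsimp only
    linarith
end

section
/- Let a, b, c₀ ∈ ℝ with a ≥ c₀ and b ≥ c₀, let F ≥ 0, and set m = max(a, b). Then the maximum over α = (α₁, α₂) ∈ [0,1]² with max(α₁, α₂) = 1 of ((α₁ + α₂ − 1)·c₀ + (1−α₁)·b + (1−α₂)·a + F·√(α₁α₂)) equals m + F²/(4(m − c₀)) if 2(m − c₀) > F, and equals c₀ + F otherwise. -/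
open Set

/-- The maximum over `[0,1]` of the concave quadratic `s ↦ m - (m - c) s² + F s`. -/
theorem isGreatest_quadratic_image_Icc {c m F : ℝ} (hc : c ≤ m) (hF : 0 ≤ F) :
    IsGreatest ((fun s : ℝ => m - (m - c) * s ^ 2 + F * s) '' Icc 0 1)
      (if 2 * (m - c) > F then m + F ^ 2 / (4 * (m - c)) else c + F) := by
  split_ifs with h
  · have hd : 0 < m - c := by linarith
    refine ⟨⟨F / (2 * (m - c)), ⟨by positivity, ?_⟩, ?_⟩, ?_⟩
    · rw [div_le_one (by positivity)]
      exact h.le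
    · field_simp
      ring
    · rintro _ ⟨s, -, rfl⟩
      have key : F * s - (m - c) * s ^ 2 ≤ F ^ 2 / (4 * (m - c)) := by
        rw [le_div_iff₀ (by positivity)]
        linarith [sq_nonneg (F - 2 * (m - c) * s)]
      dsimp only
      linarith
  · refine ⟨⟨1, by simp, by ring⟩, ?_⟩
    rintro _ ⟨s, ⟨-, hs⟩, rfl⟩
    have hcross : (m - c) * (1 + s) ≤ F := by nlinarith
    dsimp only
    nlinarith [mul_nonneg (sub_nonneg.2 hs) (sub_nonneg.2 hcross)]

/-- Closed form solution of the semi-discretised scheme (U∞): for `a, b ≥ c₀`,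
`F ≥ 0` and `m = max(a,b)`, the maximum over
`α ∈ [0,1]²` with `max(α₁,α₂) = 1` of
`(α₁+α₂−1)c₀ + (1−α₁)b + (1−α₂)a + F√(α₁α₂)` equals
`m + F²/(4(m−c₀))` if `2(m−c₀) > F`, and `c₀ + F` otherwise. -/
theorem scheme_Uinf_closed_form (a b c₀ F m : ℝ)
    (ha : c₀ ≤ a) (hb : c₀ ≤ b) (hF : 0 ≤ F) (hm : m = max a b) :
    IsGreatest
      ((fun α : ℝ × ℝ =>
          (α.1 + α.2 - 1) * c₀ + (1 - α.1) * b + (1 - α.2) * a +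
            F * Real.sqrt (α.1 * α.2)) ''
        {α : ℝ × ℝ | α.1 ∈ Icc (0:ℝ) 1 ∧ α.2 ∈ Icc (0:ℝ) 1 ∧ max α.1 α.2 = 1})
      (if 2 * (m - c₀) > F then m + F ^ 2 / (4 * (m - c₀)) else c₀ + F) := by
  have ham : a ≤ m := hm ▸ le_max_left a b
  have hbm : b ≤ m := hm ▸ le_max_right a b
  obtain ⟨⟨s, ⟨hs0, hs1⟩, hs⟩, hub⟩ := isGreatest_quadratic_image_Icc (ha.trans ham) hF
  have hsq : s ^ 2 ∈ Icc (0 : ℝ) 1 := ⟨by positivity, pow_le_one₀ hs0 hs1⟩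
  constructor
  · rw [← hs]
    rcases max_choice a b with h | h
    · refine ⟨(1, s ^ 2), ⟨by simp, hsq, max_eq_left hsq.2⟩, ?_⟩
      simp only [one_mul, Real.sqrt_sq hs0, hm.trans h]
      ring
    · refine ⟨(s ^ 2, 1), ⟨hsq, by simp, max_eq_right hsq.2⟩, ?_⟩
      simp only [mul_one, Real.sqrt_sq hs0, hm.trans h]
      ring
  · rintro _ ⟨⟨x, y⟩, ⟨hx, hy, hxy⟩, rfl⟩
    dsimp only at hx hy hxy ⊢
    rcases max_choice x y with h | h
    · obtain rfl : x = 1 := h.symm.trans hxy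
      refine le_trans ?_ (hub ⟨√y, ⟨Real.sqrt_nonneg y, Real.sqrt_le_one.2 hy.2⟩, rfl⟩)
      simp only [one_mul, Real.sq_sqrt hy.1]
      nlinarith [mul_le_mul_of_nonneg_left ham (sub_nonneg.2 hy.2)]
    · obtain rfl : y = 1 := h.symm.trans hxy
      refine le_trans ?_ (hub ⟨√x, ⟨Real.sqrt_nonneg x, Real.sqrt_le_one.2 hx.2⟩, rfl⟩)
      simp only [mul_one, Real.sq_sqrt hx.1]
      nlinarith [mul_le_mul_of_nonneg_left hbm (sub_nonneg.2 hx.2)]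
end

section
/- Let p ≥ 0, q ≥ 0 and F ≥ 0. Then the maximum over α ∈ [0,1] of (F·√(α(1−α)) + √(F²·α(1−α) + α·p + (1−α)·q))² equals ½(p + q + F² + √((p−q)² + 2(p+q)F² + F⁴)). -/
open Set

/-- Completing the square: the gap between `(√M - F√(α(1-α)))²` and the radicand of the scheme
is a perfect square whenever `(M - p)(M - q) = F²M`. -/
lemma sq_sqrt_sub_eq_add_sq {p q F M α : ℝ} (hF : 0 ≤ F) (hM : 0 ≤ M) (hpM : p ≤ M)
    (hqM : q ≤ M) (hroot : (M - p) * (M - q) = F ^ 2 * M) (h0 : 0 ≤ α) (h1 : α ≤ 1) :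
    (√M - F * √(α * (1 - α))) ^ 2 =
      F ^ 2 * (α * (1 - α)) + α * p + (1 - α) * q +
        (√(α * (M - p)) - √((1 - α) * (M - q))) ^ 2 := by
  have h1' : 0 ≤ 1 - α := by linarith
  have hA : 0 ≤ M - p := by linarith
  have hB : 0 ≤ M - q := by linarith
  have hcross : √(α * (M - p)) * √((1 - α) * (M - q)) = F * √(α * (1 - α)) * √M := by
    rw [← Real.sqrt_mul (by positivity),
      show α * (M - p) * ((1 - α) * (M - q)) = F ^ 2 * (α * (1 - α)) * M by
        linear_combination α * (1 - α) * hroot,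
      Real.sqrt_mul (by positivity), Real.sqrt_mul (by positivity), Real.sqrt_sq hF]
  have e1 := Real.sq_sqrt (mul_nonneg h0 h1')
  have e2 := Real.sq_sqrt (mul_nonneg h0 hA)
  have e3 := Real.sq_sqrt (mul_nonneg h1' hB)
  have e4 := Real.sq_sqrt hM
  linear_combination e4 + F ^ 2 * e1 - e2 - e3 + 2 * hcross

/-- If `M ≥ max p q F²` satisfies `(M - p)(M - q) = F²M`, then `M` is the maximal value of the
scheme. -/
lemma isGreatest_of_mul_sub_eq {p q F M : ℝ} (hp : 0 ≤ p) (hF : 0 ≤ F)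
    (hpM : p ≤ M) (hqM : q ≤ M) (hFM : F ^ 2 ≤ M) (hroot : (M - p) * (M - q) = F ^ 2 * M) :
    IsGreatest
      ((fun α : ℝ => (F * √(α * (1 - α)) +
          √(F ^ 2 * (α * (1 - α)) + α * p + (1 - α) * q)) ^ 2) '' Icc (0 : ℝ) 1) M := by
  have hM : 0 ≤ M := hp.trans hpM
  have hle {α : ℝ} (h0 : 0 ≤ α) (h1 : α ≤ 1) : 0 ≤ √M - F * √(α * (1 - α)) := by
    have hs : √(α * (1 - α)) ≤ 1 := Real.sqrt_le_one.2 (by nlinarith)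
    have hFx : F ≤ √M := Real.le_sqrt_of_sq_le hFM
    nlinarith
  refine ⟨?_, ?_⟩
  · obtain ⟨α, ⟨h0, h1⟩, hα⟩ :
        ∃ α ∈ Icc (0 : ℝ) 1, α * (M - p) = (1 - α) * (M - q) := by
      rcases (add_nonneg (sub_nonneg.2 hpM) (sub_nonneg.2 hqM)).eq_or_lt with h | h
      · exact ⟨0, by simp, by linarith⟩
      · refine ⟨(M - q) / (M - p + (M - q)),
          ⟨div_nonneg (by linarith) h.le, (div_le_one h).2 (by linarith)⟩, ?_⟩
        field_simp
        ring
    refine ⟨α, ⟨h0, h1⟩, ?_⟩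
    have key := sq_sqrt_sub_eq_add_sq hF hM hpM hqM hroot h0 h1
    rw [hα, sub_self, zero_pow two_ne_zero, add_zero] at key
    simp only [← key, Real.sqrt_sq (hle h0 h1), add_sub_cancel, Real.sq_sqrt hM]
  · rintro _ ⟨α, ⟨h0, h1⟩, rfl⟩
    have key := sq_sqrt_sub_eq_add_sq hF hM hpM hqM hroot h0 h1
    have hsqrt : √(F ^ 2 * (α * (1 - α)) + α * p + (1 - α) * q) ≤ √M - F * √(α * (1 - α)) :=
      Real.sqrt_le_iff.2 ⟨hle h0 h1, key ▸ le_add_of_nonneg_right (sq_nonneg _)⟩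
    calc _ ≤ √M ^ 2 := pow_le_pow_left₀ (by positivity) (by linarith) 2
      _ = M := Real.sq_sqrt hM

/-- Closed form solution of the semi-discretised scheme (V₁): for
`p, q, F ≥ 0`,
`max_{α ∈ [0,1]} (F√(α(1−α)) + √(F²α(1−α) + αp + (1−α)q))²
  = ½(p + q + F² + √((p−q)² + 2(p+q)F² + F⁴))`. -/
theorem scheme_V1_closed_form (p q F : ℝ) (hp : 0 ≤ p) (hq : 0 ≤ q)
    (hF : 0 ≤ F) :
    IsGreatest
      ((fun α : ℝ =>
          (F * Real.sqrt (α * (1 - α)) +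
            Real.sqrt (F ^ 2 * (α * (1 - α)) + α * p + (1 - α) * q)) ^ 2) ''
        Icc (0:ℝ) 1)
      ((p + q + F ^ 2 +
        Real.sqrt ((p - q) ^ 2 + 2 * (p + q) * F ^ 2 + F ^ 4)) / 2) := by
  have hD : 0 ≤ (p - q) ^ 2 + 2 * (p + q) * F ^ 2 + F ^ 4 := by positivity
  have hpq : |p - q| ≤ √((p - q) ^ 2 + 2 * (p + q) * F ^ 2 + F ^ 4) :=
    Real.abs_le_sqrt (by
      have : 0 ≤ 2 * (p + q) * F ^ 2 + F ^ 4 := by positivity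
      linarith)
  have hFD : F ^ 2 ≤ √((p - q) ^ 2 + 2 * (p + q) * F ^ 2 + F ^ 4) :=
    Real.le_sqrt_of_sq_le (by
      have : 0 ≤ (p - q) ^ 2 + 2 * (p + q) * F ^ 2 := by positivity
      linarith [show (F ^ 2) ^ 2 = F ^ 4 by ring])
  obtain ⟨hqp, hpq⟩ := abs_le.1 hpq
  have hF2 := sq_nonneg F
  refine isGreatest_of_mul_sub_eq hp hF (by linarith) (by linarith) (by linarith) ?_
  linear_combination Real.sq_sqrt hD / 4
end

section
/- Let A be a nonempty compact topological space and let b, c : A → ℝ be continuous with b(α) ≥ 0 and c(α) ≥ 0 for all α ∈ A. Define t* = max_{α ∈ A} (b(α) + √(b(α)² + c(α))). Then t* ≥ 0, max_{α ∈ A} (c(α) − t*² + 2·t*·b(α)) = 0, and t* is the largest such root: every t ≥ 0 with max_{α ∈ A} (c(α) − t² + 2·t·b(α)) = 0 satisfies t ≤ t*. -/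
open Set

theorem Continuous.isGreatest_sSup_range {A : Type*} [TopologicalSpace A] [CompactSpace A]
    [Nonempty A] {f : A → ℝ} (hf : Continuous f) :
    IsGreatest (range f) (sSup (range f)) :=
  (isCompact_range hf).isGreatest_sSup (range_nonempty f)

/-- For continuous nonnegative `b, c` on a nonempty compact space `A`, the
quantity `t* = max_{α} (b(α) + √(b(α)² + c(α)))` is nonnegative, satisfies
`max_{α} (c(α) − t*² + 2t*b(α)) = 0`, and is the largest nonnegative `t` with
`max_{α} (c(α) − t² + 2tb(α)) = 0`. -/
theorem largest_root_of_quadratic_family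
    (A : Type*) [TopologicalSpace A] [CompactSpace A] [Nonempty A]
    (b c : A → ℝ) (hb : Continuous b) (hc : Continuous c)
    (hb0 : ∀ α, 0 ≤ b α) (hc0 : ∀ α, 0 ≤ c α)
    (tstar : ℝ)
    (htstar : tstar = sSup (range fun α => b α + Real.sqrt ((b α) ^ 2 + c α))) :
    0 ≤ tstar ∧
      sSup (range fun α => c α - tstar ^ 2 + 2 * tstar * b α) = 0 ∧
      ∀ t : ℝ, 0 ≤ t →
        sSup (range fun α => c α - t ^ 2 + 2 * t * b α) = 0 → t ≤ tstar := by
  have hmax : IsGreatest (range fun α => b α + Real.sqrt ((b α) ^ 2 + c α)) tstar :=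
    htstar ▸ Continuous.isGreatest_sSup_range (by fun_prop)
  have hle (α : A) : b α + Real.sqrt ((b α) ^ 2 + c α) ≤ tstar := hmax.2 (mem_range_self α)
  have hsq (α : A) : Real.sqrt ((b α) ^ 2 + c α) ^ 2 = (b α) ^ 2 + c α :=
    Real.sq_sqrt (add_nonneg (sq_nonneg _) (hc0 α))
  obtain ⟨α₀, hα₀⟩ := hmax.1
  refine ⟨?_, ?_, fun t _ hroot => ?_⟩
  · rw [← hα₀]
    exact add_nonneg (hb0 α₀) (Real.sqrt_nonneg _)
  · refine IsGreatest.csSup_eq ⟨⟨α₀, ?_⟩, ?_⟩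
    · simp only [← hα₀]
      linear_combination -hsq α₀
    · rintro _ ⟨α, rfl⟩
      have hs : Real.sqrt ((b α) ^ 2 + c α) ≤ tstar - b α := by linarith [hle α]
      have := (Real.sqrt_le_left (by linarith [Real.sqrt_nonneg ((b α) ^ 2 + c α)])).1 hs
      linarith
  · have hcont : Continuous fun α => c α - t ^ 2 + 2 * t * b α := by fun_prop
    obtain ⟨α, hα⟩ := hcont.isGreatest_sSup_range.1
    rw [hroot] at hα
    have hs : t - b α ≤ Real.sqrt ((b α) ^ 2 + c α) :=
      Real.le_sqrt_of_sq_le (by linarith)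
    linarith [hle α]
end

section
/- Let N ≥ 1, h = 1/N, and let f : {0,…,N}² → ℝ be nonnegative with f(i,j) ≤ M for all i, j. Define u : {0,…,N}² → ℝ by u(i,0) = u(0,j) = 0 for all i, j, and for i, j ≥ 1 by the recursion u(i,j) = ½( u(i−1,j) + u(i,j−1) + √((u(i−1,j) − u(i,j−1))² + (h·f(i,j))²) ). Then for all i, j: u(i,j) ≥ max(u(i−1,j), u(i,j−1)) (when i, j ≥ 1), and 0 ≤ u(i,j) ≤ (i+j)·h·M/2 ≤ M. In particular the scheme is stable uniformly in h. -/
theorem max_le_add_add_sqrt_div_two (a b c : ℝ) :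
    max a b ≤ (a + b + Real.sqrt ((a - b) ^ 2 + c ^ 2)) / 2 := by
  have h : |a - b| ≤ Real.sqrt ((a - b) ^ 2 + c ^ 2) :=
    Real.abs_le_sqrt (le_add_of_nonneg_right (sq_nonneg c))
  obtain ⟨h₁, h₂⟩ := abs_le.mp h
  exact max_le (by linarith) (by linarith)

theorem add_add_sqrt_div_two_le_max_add (a b : ℝ) {c : ℝ} (hc : 0 ≤ c) :
    (a + b + Real.sqrt ((a - b) ^ 2 + c ^ 2)) / 2 ≤ max a b + c / 2 := by
  have h : Real.sqrt ((a - b) ^ 2 + c ^ 2) ≤ |a - b| + c := by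
    refine Real.sqrt_le_iff.mpr ⟨by positivity, ?_⟩
    nlinarith [sq_abs (a - b), mul_nonneg (abs_nonneg (a - b)) hc]
  have h' : max a b = (a + b + |a - b|) / 2 := by
    linarith [max_add_min a b, max_sub_min_eq_abs' a b]
  rw [h']
  linarith


/-- Stability of the semi-discretised scheme (U₁): with `h = 1/N` and
`0 ≤ f ≤ M` on the grid, the solution `u` of the recursion
`u(i,j) = ½(u(i−1,j) + u(i,j−1) + √((u(i−1,j) − u(i,j−1))² + (hf(i,j))²))`
with zero boundary values is monotone along the recursion and satisfies
`0 ≤ u(i,j) ≤ (i+j)hM/2 ≤ M`, uniformly in `h`. -/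
theorem scheme_U1_stability (N : ℕ) (hN : 1 ≤ N) (h M : ℝ) (hh : h = 1 / N)
    (f : ℕ → ℕ → ℝ)
    (hf0 : ∀ i j, i ≤ N → j ≤ N → 0 ≤ f i j)
    (hfM : ∀ i j, i ≤ N → j ≤ N → f i j ≤ M)
    (u : ℕ → ℕ → ℝ)
    (hu₁ : ∀ i, u i 0 = 0) (hu₂ : ∀ j, u 0 j = 0)
    (hrec : ∀ i j, 1 ≤ i → i ≤ N → 1 ≤ j → j ≤ N →
      u i j = (u (i - 1) j + u i (j - 1) +
        Real.sqrt ((u (i - 1) j - u i (j - 1)) ^ 2 + (h * f i j) ^ 2)) / 2) :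
    (∀ i j, 1 ≤ i → i ≤ N → 1 ≤ j → j ≤ N →
        max (u (i - 1) j) (u i (j - 1)) ≤ u i j) ∧
      ∀ i j, i ≤ N → j ≤ N →
        0 ≤ u i j ∧ u i j ≤ ((i : ℝ) + j) * h * M / 2 ∧
          ((i : ℝ) + j) * h * M / 2 ≤ M := by
  have hN' : (0 : ℝ) < N := by exact_mod_cast hN
  have hh0 : 0 ≤ h := by rw [hh]; positivity
  have hhN : h * N = 1 := by rw [hh]; field_simp
  have hM : 0 ≤ M := (hf0 0 0 N.zero_le N.zero_le).trans (hfM 0 0 N.zero_le N.zero_le)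
  have hmono : ∀ i j, 1 ≤ i → i ≤ N → 1 ≤ j → j ≤ N →
      max (u (i - 1) j) (u i (j - 1)) ≤ u i j := by
    intro i j hi hiN hj hjN
    rw [hrec i j hi hiN hj hjN]
    exact max_le_add_add_sqrt_div_two _ _ _
  have hbound : ∀ i j, i ≤ N → j ≤ N → 0 ≤ u i j ∧ u i j ≤ ((i : ℝ) + j) * h * M / 2 := by
    intro i
    induction i with
    | zero => exact fun j _ _ => by rw [hu₂]; exact ⟨le_rfl, by positivity⟩
    | succ i ihi =>
      intro j hi
      induction j with
      | zero => exact fun _ => by rw [hu₁]; exact ⟨le_rfl, by positivity⟩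
      | succ j ihj =>
        intro hj
        obtain ⟨ha₀, ha⟩ := ihi (j + 1) (by omega) hj
        obtain ⟨-, hb⟩ := ihj (by omega)
        have hlow := hmono (i + 1) (j + 1) (by omega) hi (by omega) hj
        refine ⟨ha₀.trans ((le_max_left _ _).trans hlow), ?_⟩
        have hfh : h * f (i + 1) (j + 1) ≤ h * M :=
          mul_le_mul_of_nonneg_left (hfM _ _ hi hj) hh0
        have hup := add_add_sqrt_div_two_le_max_add (u i (j + 1)) (u (i + 1) j)
          (mul_nonneg hh0 (hf0 _ _ hi hj))
        have hr := hrec (i + 1) (j + 1) (by omega) hi (by omega) hj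
        simp only [Nat.add_sub_cancel] at hr
        rw [← hr] at hup
        push_cast at ha hb ⊢
        have hmax : max (u i (j + 1)) (u (i + 1) j) ≤ ((i : ℝ) + j + 1) * h * M / 2 :=
          max_le (by linarith) (by linarith)
        linarith
  refine ⟨hmono, fun i j hi hj => ⟨(hbound i j hi hj).1, (hbound i j hi hj).2, ?_⟩⟩
  have hi' : (i : ℝ) ≤ N := by exact_mod_cast hi
  have hj' : (j : ℝ) ≤ N := by exact_mod_cast hj
  calc ((i : ℝ) + j) * h * M / 2 ≤ ((N : ℝ) + N) * h * M / 2 := by gcongr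
    _ = h * N * M := by ring
    _ = M := by rw [hhN, one_mul]
end

section
/- Let c : ℝ → ℝ^d be differentiable at t with c'(t) ≠ 0. Then the backward-difference approximation of the (unscaled) square root velocity is consistent: lim as h → 0⁺ of (c(t) − c(t−h)) / √(h·|c(t) − c(t−h)|) = c'(t) / √(|c'(t)|). -/
open Set Filter

/-- Consistency of the backward-difference approximation of the (unscaled)
square root velocity: if `c` is differentiable at `t` with derivative
`c'(t) ≠ 0`, then `(c(t) − c(t−h)) / √(h·|c(t) − c(t−h)|) → c'(t)/√|c'(t)|`
as `h → 0⁺`. -/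
theorem srv_backward_difference_consistent {d : ℕ}
    (c : ℝ → EuclideanSpace ℝ (Fin d)) (t : ℝ)
    (c' : EuclideanSpace ℝ (Fin d))
    (hd : HasDerivAt c c' t) (hne : c' ≠ 0) :
    Tendsto
      (fun h : ℝ => (Real.sqrt (h * ‖c t - c (t - h)‖))⁻¹ • (c t - c (t - h)))
      (nhdsWithin 0 (Ioi 0))
      (nhds ((Real.sqrt ‖c'‖)⁻¹ • c')) := by
  have hslope : Tendsto (fun h : ℝ => h⁻¹ • (c t - c (t - h)))
      (nhdsWithin 0 (Ioi 0)) (nhds c') := by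
    have hneg : Tendsto (fun h : ℝ => -h) (nhdsWithin 0 (Ioi 0)) (nhdsWithin 0 (Iio 0)) := by
      simpa using tendsto_neg_nhdsGT (a := (0 : ℝ))
    refine (hd.tendsto_slope_zero_left.comp hneg).congr fun h => ?_
    simp only [Function.comp_apply, ← sub_eq_add_neg, inv_neg, neg_smul, ← smul_neg, neg_sub]
  have hsqrt : Real.sqrt ‖c'‖ ≠ 0 := (Real.sqrt_pos.2 (norm_pos_iff.2 hne)).ne'
  refine ((hslope.norm.sqrt.inv₀ hsqrt).smul hslope).congr' ?_
  filter_upwards [self_mem_nhdsWithin] with h (hh : 0 < h)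
  have hscale : h * ‖c t - c (t - h)‖ = h ^ 2 * ‖h⁻¹ • (c t - c (t - h))‖ := by
    rw [norm_smul, Real.norm_of_nonneg (inv_nonneg.2 hh.le)]
    field_simp
  rw [hscale, Real.sqrt_mul (sq_nonneg h), Real.sqrt_sq hh.le, mul_inv, smul_smul, mul_comm]
end
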